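/- arXiv:0809.1387 — 3 statements merged into one kernel-verified Lean document; each statement's English description precedes it below -/
import Mathlib

section
/- There is no measurable function f : (0,∞) → ℝ with ∫₀^∞ f(r)² r⁻¹ dr < ∞ such that for every real r₀ > 0 one has exp(−r₀ r/2) − exp(−r/2) = f(r₀ r) − f(r) for Lebesgue-almost every r > 0. -/
open MeasureTheory

/-- The restriction of the cocycle `b(r₀)(r) = e^{−r₀ r/2} − e^{−r/2}` to the
dilation subgroup is not a coboundary: there is no measurable `f : (0,∞) → ℝ` with
`∫₀^∞ f(r)² r⁻¹ dr < ∞` such that for every `r₀ > 0`,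
`e^{−r₀ r/2} − e^{−r/2} = f(r₀ r) − f(r)` for a.e. `r > 0`. -/
theorem dilation_cocycle_not_coboundary :
    ¬ ∃ f : ℝ → ℝ, Measurable f ∧
      IntegrableOn (fun r : ℝ => f r ^ 2 / r) (Set.Ioi 0) volume ∧
      ∀ r₀ : ℝ, 0 < r₀ →
        ∀ᵐ r ∂(volume.restrict (Set.Ioi (0 : ℝ))),
          Real.exp (-(r₀ * r) / 2) - Real.exp (-r / 2) = f (r₀ * r) - f r := by
  rintro ⟨f, -, hint, hf⟩
  set C := ∫ r in Set.Ioi (0 : ℝ), f r ^ 2 / r with hC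
  have hC0 : 0 ≤ C := setIntegral_nonneg measurableSet_Ioi fun r hr => by
    have : (0 : ℝ) < r := hr
    positivity
  set L : ℝ := 16 * C + 1 with hL
  set t : ℝ := 16 * Real.exp L with ht
  have hexp : 1 ≤ Real.exp L := Real.one_le_exp (by positivity)
  have htpos : 0 < t := by positivity
  have heq : ∀ r : ℝ, t * (f (t * r) ^ 2 / (t * r)) = f (t * r) ^ 2 / r := fun r => by
    field_simp
  -- the dilated function is integrable with the same integral
  have hint2 : IntegrableOn (fun r : ℝ => f (t * r) ^ 2 / r) (Set.Ioi 0) volume := by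
    have h := (integrableOn_Ioi_comp_mul_left_iff (fun r : ℝ => f r ^ 2 / r) 0 htpos).2
      (by simpa using hint)
    have h2 := h.const_mul t
    simp only [heq] at h2
    exact h2
  have hval2 : ∫ r in Set.Ioi (0 : ℝ), f (t * r) ^ 2 / r = C := by
    have h := integral_comp_mul_left_Ioi (fun r : ℝ => f r ^ 2 / r) 0 htpos
    simp only [mul_zero, smul_eq_mul] at h
    simp only [← heq]
    rw [integral_const_mul, h, ← mul_assoc, mul_inv_cancel₀ htpos.ne', one_mul]
  have hsum := hint2.add hint
  have htot : ∫ r in Set.Ioi (0 : ℝ), (f (t * r) ^ 2 / r + f r ^ 2 / r) = 2 * C := by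
    rw [integral_add hint2 hint, hval2]; ring
  have ha : 0 < 4 / t := by positivity
  have hab : 4 / t ≤ 1 / 4 := by
    rw [div_le_div_iff₀ htpos (by norm_num)]; linarith
  have hsub : Set.Ioc (4 / t) (1 / 4) ⊆ Set.Ioi (0 : ℝ) := fun r hr => ha.trans hr.1
  have hle1 : ∫ r in Set.Ioc (4 / t) (1 / 4), (f (t * r) ^ 2 / r + f r ^ 2 / r) ≤ 2 * C := by
    rw [← htot]
    refine setIntegral_mono_set hsum ?_ hsub.eventuallyLE
    filter_upwards [ae_restrict_mem measurableSet_Ioi] with r hr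
    have : (0 : ℝ) < r := hr
    simp only [Pi.zero_apply]
    positivity
  have hinv : IntegrableOn (fun r : ℝ => 1 / 8 * r⁻¹) (Set.Ioc (4 / t) (1 / 4)) volume := by
    refine IntegrableOn.mono_set (ContinuousOn.integrableOn_Icc ?_) Set.Ioc_subset_Icc_self
    refine continuousOn_const.mul (continuousOn_inv₀.mono fun r hr => ?_)
    exact (ha.trans_le hr.1).ne'
  have hle2 : ∫ r in Set.Ioc (4 / t) (1 / 4), (1 / 8 * r⁻¹) ≤
      ∫ r in Set.Ioc (4 / t) (1 / 4), (f (t * r) ^ 2 / r + f r ^ 2 / r) := by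
    refine integral_mono_ae hinv (hsum.mono_set hsub) ?_
    filter_upwards [ae_restrict_mem measurableSet_Ioc,
      ae_restrict_of_ae_restrict_of_subset hsub (hf t htpos)] with r hr h
    have hr0 : 0 < r := hsub hr
    have htr : 4 ≤ t * r := by
      have := (div_lt_iff₀ htpos).1 hr.1
      linarith
    have h1 : 7 / 8 ≤ Real.exp (-r / 2) := by
      have := Real.add_one_le_exp (-r / 2)
      have := hr.2
      linarith
    have h2 : Real.exp (-(t * r) / 2) ≤ 3 / 8 := by
      have h3 := Real.add_one_le_exp (t * r / 2)
      have h4 : Real.exp (-(t * r) / 2) * Real.exp (t * r / 2) = 1 := by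
        rw [← Real.exp_add]; ring_nf; simp
      have h5 := Real.exp_pos (-(t * r) / 2)
      nlinarith
    have h6 : 1 / 2 ≤ f r - f (t * r) := by linarith
    have h7 : 1 / 8 ≤ f (t * r) ^ 2 + f r ^ 2 := by
      nlinarith [sq_nonneg (f r + f (t * r))]
    change 1 / 8 * r⁻¹ ≤ f (t * r) ^ 2 / r + f r ^ 2 / r
    rw [← add_div, div_eq_mul_inv (f (t * r) ^ 2 + f r ^ 2)]
    gcongr
  have hlog : ∫ r in Set.Ioc (4 / t) (1 / 4), (1 / 8 * r⁻¹) = 1 / 8 * L := by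
    rw [← intervalIntegral.integral_of_le hab, intervalIntegral.integral_const_mul,
      integral_inv_of_pos ha (by norm_num)]
    have : (1 / 4 : ℝ) / (4 / t) = Real.exp L := by
      rw [ht]; field_simp; norm_num
    rw [this, Real.log_exp]
  linarith
end

section
/- Let H be a complex inner product space with inner product ⟨·,·⟩ linear in the first argument, let A₁, A₂ : H → H be linear isometries, and let b₁, b₂ ∈ H. Then for every v ∈ H: exp(−‖b₁‖²/2 − ⟨A₁(A₂ v + b₂), b₁⟩) · exp(−‖b₂‖²/2 − ⟨A₂ v, b₂⟩) = exp(−i · Im⟨A₁ b₂, b₁⟩) · exp(−‖A₁ b₂ + b₁‖²/2 − ⟨A₁ A₂ v, A₁ b₂ + b₁⟩). -/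
open scoped InnerProductSpace

/-- The projective multiplier relation for Fock representation operators on
exponential vectors. Here `⟨x, y⟩` denotes the inner product *linear in the first
argument*, i.e. `⟪y, x⟫_ℂ` in Mathlib's convention: for linear isometries `A₁, A₂`
and `b₁, b₂, v ∈ H`,
`exp(−‖b₁‖²/2 − ⟨A₁(A₂v+b₂), b₁⟩) · exp(−‖b₂‖²/2 − ⟨A₂v, b₂⟩)
  = exp(−i·Im⟨A₁b₂, b₁⟩) · exp(−‖A₁b₂+b₁‖²/2 − ⟨A₁A₂v, A₁b₂+b₁⟩)`. -/
theorem fock_projective_multiplier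
    {H : Type*} [NormedAddCommGroup H] [InnerProductSpace ℂ H]
    (A₁ A₂ : H →ₗᵢ[ℂ] H) (b₁ b₂ v : H) :
    Complex.exp (-((‖b₁‖ : ℂ) ^ 2) / 2 - ⟪b₁, A₁ (A₂ v + b₂)⟫_ℂ) *
        Complex.exp (-((‖b₂‖ : ℂ) ^ 2) / 2 - ⟪b₂, A₂ v⟫_ℂ) =
      Complex.exp (-(Complex.I * ((⟪b₁, A₁ b₂⟫_ℂ).im : ℂ))) *
        Complex.exp (-((‖A₁ b₂ + b₁‖ : ℂ) ^ 2) / 2 -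
          ⟪A₁ b₂ + b₁, A₁ (A₂ v)⟫_ℂ) := by
  have hn : ((‖A₁ b₂ + b₁‖ : ℂ)) ^ 2 =
      (‖b₂‖ : ℂ) ^ 2 + 2 * ((⟪b₁, A₁ b₂⟫_ℂ).re : ℂ) + (‖b₁‖ : ℂ) ^ 2 := by
    have h := @norm_add_sq ℂ H _ _ _ (A₁ b₂) b₁
    rw [A₁.norm_map, inner_re_symm] at h
    exact_mod_cast h
  have hz := Complex.re_add_im ⟪b₁, A₁ b₂⟫_ℂ
  rw [← Complex.exp_add, ← Complex.exp_add, hn, map_add, inner_add_right, inner_add_left,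
    A₁.inner_map_map]
  congr 1
  linear_combination hz
end

section
/- Let n ≥ 1, let J be the (n+1)×(n+1) complex Hermitian matrix of the form x₁·conj(x_{n+1}) + x_{n+1}·conj(x₁) + |x₂|² + … + |x_n|², and let g be a complex (n+1)×(n+1) matrix with gᴴ J g = J, written in block form g = (g_{ij})_{i,j=1,2,3} with diagonal blocks of sizes 1, n−1, 1. For i = 1, 2 let (a_i, b_i) ∈ ℂ × ℂ^{n−1} satisfy a_i + conj(a_i) + b_iᴴ b_i < 0, and set d_i = g₁₁ + g₁₂ b_i + g₁₃ a_i, a_i' = d_i⁻¹ (g₃₁ + g₃₂ b_i + g₃₃ a_i), b_i' = d_i⁻¹ (g₂₁ + g₂₂ b_i + g₂₃ a_i). Then −a₁' − conj(a₂') − (b₂')ᴴ b₁' = (−a₁ − conj(a₂) − b₂ᴴ b₁) / (d₁ · conj(d₂)). -/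
open Matrix ComplexConjugate
open scoped ComplexOrder

/-- Index type for the block decomposition of `(n+1)×(n+1)` matrices into blocks of
sizes `1`, `m = n−1`, `1`. -/
abbrev BIdx (m : ℕ) := Fin 1 ⊕ Fin m ⊕ Fin 1

/-- The matrix `J` of the Hermitian form
`x₁·conj x_{n+1} + x_{n+1}·conj x₁ + |x₂|² + … + |x_n|²`. -/
def Jmat (m : ℕ) : Matrix (BIdx m) (BIdx m) ℂ := fun i j =>
  match i, j with
  | Sum.inl _, Sum.inr (Sum.inr _) => 1
  | Sum.inr (Sum.inr _), Sum.inl _ => 1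
  | Sum.inr (Sum.inl i), Sum.inr (Sum.inl j) => if i = j then 1 else 0
  | _, _ => 0

/-- The denominator `d = g₁₁ + g₁₂ b + g₁₃ a` of the fractional-linear action of a
block matrix `g` at the point `v = (a, b) ∈ ℂ × ℂ^m`. -/
noncomputable def uDenom {m : ℕ} (g : Matrix (BIdx m) (BIdx m) ℂ) (v : ℂ × (Fin m → ℂ)) : ℂ :=
  g (Sum.inl 0) (Sum.inl 0) +
    (∑ j, g (Sum.inl 0) (Sum.inr (Sum.inl j)) * v.2 j) +
    g (Sum.inl 0) (Sum.inr (Sum.inr 0)) * v.1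

/-- The fractional-linear action
`g·(a,b) = (d⁻¹(g₃₁+g₃₂b+g₃₃a), d⁻¹(g₂₁+g₂₂b+g₂₃a))`, `d = g₁₁+g₁₂b+g₁₃a`. -/
noncomputable def uAct {m : ℕ} (g : Matrix (BIdx m) (BIdx m) ℂ)
    (v : ℂ × (Fin m → ℂ)) : ℂ × (Fin m → ℂ) :=
  ((uDenom g v)⁻¹ *
      (g (Sum.inr (Sum.inr 0)) (Sum.inl 0) +
        (∑ j, g (Sum.inr (Sum.inr 0)) (Sum.inr (Sum.inl j)) * v.2 j) +
        g (Sum.inr (Sum.inr 0)) (Sum.inr (Sum.inr 0)) * v.1),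
    fun i => (uDenom g v)⁻¹ *
      (g (Sum.inr (Sum.inl i)) (Sum.inl 0) +
        (∑ j, g (Sum.inr (Sum.inl i)) (Sum.inr (Sum.inl j)) * v.2 j) +
        g (Sum.inr (Sum.inl i)) (Sum.inr (Sum.inr 0)) * v.1))

/-- The quantity `a + conj a + bᴴb` defining the complex Lobachevsky space
`L = {(a,b) : a + conj a + bᴴb < 0}`. -/
noncomputable def lForm {m : ℕ} (v : ℂ × (Fin m → ℂ)) : ℂ :=
  v.1 + conj v.1 + ∑ j, conj (v.2 j) * v.2 j

/-- Homogeneous coordinates of a point `(a, b)`. -/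
def homVec {m : ℕ} (v : ℂ × (Fin m → ℂ)) : BIdx m → ℂ :=
  Sum.elim (fun _ => 1) (Sum.elim v.2 (fun _ => v.1))

lemma form_expand {m : ℕ} (x y : BIdx m → ℂ) :
    star y ⬝ᵥ (Jmat m *ᵥ x) =
      conj (y (Sum.inl 0)) * x (Sum.inr (Sum.inr 0)) +
      conj (y (Sum.inr (Sum.inr 0))) * x (Sum.inl 0) +
      ∑ j, conj (y (Sum.inr (Sum.inl j))) * x (Sum.inr (Sum.inl j)) := by
  simp [dotProduct, Matrix.mulVec, Jmat, Fintype.sum_sum_type]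
  ring

lemma form_inv {m : ℕ} (g : Matrix (BIdx m) (BIdx m) ℂ)
    (hg : g.conjTranspose * Jmat m * g = Jmat m) (x y : BIdx m → ℂ) :
    star (g *ᵥ y) ⬝ᵥ (Jmat m *ᵥ (g *ᵥ x)) = star y ⬝ᵥ (Jmat m *ᵥ x) := by
  conv_rhs => rw [← hg]
  rw [Matrix.star_mulVec, ← Matrix.dotProduct_mulVec, Matrix.mulVec_mulVec,
    Matrix.mulVec_mulVec, Matrix.mul_assoc]

lemma row_expand {m : ℕ} (g : Matrix (BIdx m) (BIdx m) ℂ) (v : ℂ × (Fin m → ℂ)) (i : BIdx m) :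
    (g *ᵥ homVec v) i = g i (Sum.inl 0) + (∑ j, g i (Sum.inr (Sum.inl j)) * v.2 j) +
      g i (Sum.inr (Sum.inr 0)) * v.1 := by
  simp [dotProduct, Matrix.mulVec, homVec, Fintype.sum_sum_type, add_assoc]

lemma denom_eq {m : ℕ} (g : Matrix (BIdx m) (BIdx m) ℂ) (v : ℂ × (Fin m → ℂ)) :
    uDenom g v = (g *ᵥ homVec v) (Sum.inl 0) := by
  rw [row_expand]; rfl

lemma act_fst {m : ℕ} (g : Matrix (BIdx m) (BIdx m) ℂ) (v : ℂ × (Fin m → ℂ)) :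
    (uAct g v).1 = (uDenom g v)⁻¹ * (g *ᵥ homVec v) (Sum.inr (Sum.inr 0)) := by
  rw [row_expand]; rfl

lemma act_snd {m : ℕ} (g : Matrix (BIdx m) (BIdx m) ℂ) (v : ℂ × (Fin m → ℂ)) (i : Fin m) :
    (uAct g v).2 i = (uDenom g v)⁻¹ * (g *ᵥ homVec v) (Sum.inr (Sum.inl i)) := by
  rw [row_expand]; rfl

lemma form_hom {m : ℕ} (v w : ℂ × (Fin m → ℂ)) :
    star (homVec w) ⬝ᵥ (Jmat m *ᵥ homVec v) =
      v.1 + conj w.1 + ∑ j, conj (w.2 j) * v.2 j := by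
  rw [form_expand]; simp [homVec]

lemma denom_ne {m : ℕ} (g : Matrix (BIdx m) (BIdx m) ℂ)
    (hg : g.conjTranspose * Jmat m * g = Jmat m) (v : ℂ × (Fin m → ℂ))
    (hv : lForm v < 0) : uDenom g v ≠ 0 := by
  intro h
  have e := form_inv g hg (homVec v) (homVec v)
  rw [form_hom, form_expand, ← denom_eq, h] at e
  have e2 : lForm v = ∑ j, conj ((g *ᵥ homVec v) (Sum.inr (Sum.inl j))) *
      (g *ᵥ homVec v) (Sum.inr (Sum.inl j)) := by
    rw [lForm, ← e]; simp
  have : 0 ≤ lForm v := by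
    rw [e2]
    exact Finset.sum_nonneg fun j _ => star_mul_self_nonneg _
  exact absurd hv (not_lt_of_ge this)

/-- Transformation law of the two-point kernel `−a₁ − conj a₂ − b₂ᴴb₁` under the
action of `U(n,1)`: for `g` with `gᴴ J g = J` and points `(a₁,b₁), (a₂,b₂) ∈ L`,
`−a₁' − conj a₂' − (b₂')ᴴ b₁' = (−a₁ − conj a₂ − b₂ᴴb₁)/(d₁ · conj d₂)`. -/
theorem kernel_transformation_law (n : ℕ) (hn : 1 ≤ n)
    (g : Matrix (BIdx (n - 1)) (BIdx (n - 1)) ℂ)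
    (hg : g.conjTranspose * Jmat (n - 1) * g = Jmat (n - 1))
    (a₁ a₂ : ℂ) (b₁ b₂ : Fin (n - 1) → ℂ)
    (h₁ : lForm (a₁, b₁) < 0) (h₂ : lForm (a₂, b₂) < 0) :
    -(uAct g (a₁, b₁)).1 - conj (uAct g (a₂, b₂)).1 -
        (∑ j, conj ((uAct g (a₂, b₂)).2 j) * (uAct g (a₁, b₁)).2 j) =
      (-a₁ - conj a₂ - ∑ j, conj (b₂ j) * b₁ j) /
        (uDenom g (a₁, b₁) * conj (uDenom g (a₂, b₂))) := by
  have d₁ := denom_ne g hg _ h₁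
  have d₂ := denom_ne g hg _ h₂
  have d₂' : conj (uDenom g (a₂, b₂)) ≠ 0 := by simpa using d₂
  have e := form_inv g hg (homVec (a₁, b₁)) (homVec (a₂, b₂))
  rw [form_hom, form_expand, ← denom_eq, ← denom_eq] at e
  have hs : ∑ j, conj ((uAct g (a₂, b₂)).2 j) * (uAct g (a₁, b₁)).2 j =
      (conj (uDenom g (a₂, b₂)))⁻¹ * (uDenom g (a₁, b₁))⁻¹ *
      ∑ j, conj ((g *ᵥ homVec (a₂, b₂)) (Sum.inr (Sum.inl j))) *
        (g *ᵥ homVec (a₁, b₁)) (Sum.inr (Sum.inl j)) := by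
    rw [Finset.mul_sum]
    refine Finset.sum_congr rfl fun j _ => ?_
    rw [act_snd, act_snd, map_mul, map_inv₀]
    ring
  rw [hs, act_fst, act_fst, map_mul, map_inv₀]
  field_simp
  linear_combination -e
end
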